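/- Let k₊, k₋ be orthonormal vectors in ℂ^n and 0 < a, b ≤ 1/4. Let λ = (1 − √(1−4b))/2, φ = √a(k₊⊗e₀) + √(1−a)(k₊⊗e₁), ψ₁ = √(1−λ)(k₋⊗e₁) − √λ(k₋⊗e₀), ψ₂ = k₋⊗e₁, ψ₃ = √(1−λ)(k₋⊗e₁) + √λ(k₋⊗e₀). Define Π₀ = |k₊⟩⟨k₊|⊗|0⟩⟨0| + |k₋⟩⟨k₋|⊗|0⟩⟨0|, Π₁ = |φ⟩⟨φ| + |ψ₁⟩⟨ψ₁|, Π₂ = |φ⟩⟨φ| + |ψ₂⟩⟨ψ₂|, Π₃ = |φ⟩⟨φ| + |ψ₃⟩⟨ψ₃|. Then each Π_i is a projection (Π_i = Π_iᴴ, Π_i² = Π_i) and Π₀ Π₃ Π₂ Π₁ Π₀ = (a|k₊⟩⟨k₊| − b|k₋⟩⟨k₋|) ⊗ |0⟩⟨0|. -/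

import Mathlib

open Matrix Kronecker

/-- The outer product `|u⟩⟨v| = u vᴴ`. -/
def outer {n : Type*} [Fintype n] (u v : n → ℂ) : Matrix n n ℂ :=
  Matrix.vecMulVec u (star v)

/-- The Kronecker (tensor) product of vectors, `(u ⊗ v) (i,j) = u i * v j`. -/
def tensorVec {n : ℕ} (u : Fin n → ℂ) (v : Fin 2 → ℂ) : Fin n × Fin 2 → ℂ :=
  fun p => u p.1 * v p.2

/-- The standard basis vector `e₀` of ℂ². -/
def e₀ : Fin 2 → ℂ := ![1, 0]

/-- The standard basis vector `e₁` of ℂ². -/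
def e₁ : Fin 2 → ℂ := ![0, 1]

/-- A projection: Hermitian and idempotent. -/
def IsProjection {m : Type*} [Fintype m] [DecidableEq m] (P : Matrix m m ℂ) : Prop :=
  P.IsHermitian ∧ P * P = P

theorem outer_mul_outer' {n : Type*} [Fintype n] (u v w z : n → ℂ) :
    outer u v * outer w z = (star v ⬝ᵥ w) • outer u z := by
  unfold outer
  ext i j
  simp [Matrix.mul_apply, Matrix.vecMulVec_apply, dotProduct, Finset.sum_mul]
  refine Finset.sum_congr rfl fun x _ => ?_
  ring

theorem outer_herm {n : Type*} [Fintype n] (u : n → ℂ) : (outer u u)ᴴ = outer u u := by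
  unfold outer
  ext i j
  simp [Matrix.vecMulVec_apply, mul_comm]

theorem outer_tensor {n : ℕ} (u : Fin n → ℂ) (v : Fin 2 → ℂ) :
    outer (tensorVec u v) (tensorVec u v) = outer u u ⊗ₖ outer v v := by
  unfold outer tensorVec
  ext ⟨i, i'⟩ ⟨j, j'⟩
  simp [Matrix.vecMulVec_apply, Matrix.kroneckerMap_apply]
  ring

theorem block_mul {n : ℕ} {K L : Matrix (Fin n) (Fin n) ℂ} (hK : K * K = K) (hL : L * L = L)
    (hKL : K * L = 0) (hLK : L * K = 0) (A B A' B' : Matrix (Fin 2) (Fin 2) ℂ) :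
    (K ⊗ₖ A + L ⊗ₖ B) * (K ⊗ₖ A' + L ⊗ₖ B') = K ⊗ₖ (A * A') + L ⊗ₖ (B * B') := by
  simp [add_mul, mul_add, ← Matrix.mul_kronecker_mul, hK, hL, hKL, hLK]

theorem block_proj {n : ℕ} {u v : Fin n → ℂ} (hK : outer u u * outer u u = outer u u)
    (hL : outer v v * outer v v = outer v v)
    (hKL : outer u u * outer v v = 0) (hLK : outer v v * outer u u = 0) (x y : Fin 2 → ℂ)
    (hx : star x ⬝ᵥ x = 1) (hy : star y ⬝ᵥ y = 1) :
    IsProjection (outer u u ⊗ₖ outer x x + outer v v ⊗ₖ outer y y) := by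
  constructor
  · simp [Matrix.IsHermitian, Matrix.conjTranspose_kronecker, outer_herm]
  · rw [block_mul hK hL hKL hLK, outer_mul_outer', outer_mul_outer', hx, hy, one_smul, one_smul]

/-- decomposition of the extended rank-two witness
`(a|k₊⟩⟨k₊| − b|k₋⟩⟨k₋|) ⊗ |0⟩⟨0|` as an ordered product `P₀ P₃ P₂ P₁ P₀` of projections. -/
theorem rank_two_witness_projector_decomposition
    (n : ℕ) (kp km : Fin n → ℂ)
    (hkp : star kp ⬝ᵥ kp = 1) (hkm : star km ⬝ᵥ km = 1) (hortho : star kp ⬝ᵥ km = 0)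
    (a b lam : ℝ) (ha : 0 < a) (ha' : a ≤ 1 / 4) (hb : 0 < b) (hb' : b ≤ 1 / 4)
    (hlam : lam = (1 - Real.sqrt (1 - 4 * b)) / 2)
    (φ ψ₁ ψ₂ ψ₃ : Fin n × Fin 2 → ℂ)
    (hφ : φ = (Real.sqrt a : ℂ) • tensorVec kp e₀ + (Real.sqrt (1 - a) : ℂ) • tensorVec kp e₁)
    (hψ₁ : ψ₁ = (Real.sqrt (1 - lam) : ℂ) • tensorVec km e₁ - (Real.sqrt lam : ℂ) • tensorVec km e₀)
    (hψ₂ : ψ₂ = tensorVec km e₁)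
    (hψ₃ : ψ₃ = (Real.sqrt (1 - lam) : ℂ) • tensorVec km e₁ + (Real.sqrt lam : ℂ) • tensorVec km e₀)
    (P₀ P₁ P₂ P₃ : Matrix (Fin n × Fin 2) (Fin n × Fin 2) ℂ)
    (hP₀ : P₀ = outer kp kp ⊗ₖ outer e₀ e₀ + outer km km ⊗ₖ outer e₀ e₀)
    (hP₁ : P₁ = outer φ φ + outer ψ₁ ψ₁)
    (hP₂ : P₂ = outer φ φ + outer ψ₂ ψ₂)
    (hP₃ : P₃ = outer φ φ + outer ψ₃ ψ₃) :
    (IsProjection P₀ ∧ IsProjection P₁ ∧ IsProjection P₂ ∧ IsProjection P₃) ∧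
      P₀ * P₃ * P₂ * P₁ * P₀
        = ((a : ℂ) • outer kp kp - (b : ℂ) • outer km km) ⊗ₖ outer e₀ e₀ := by
  have hK : outer kp kp * outer kp kp = outer kp kp := by rw [outer_mul_outer', hkp, one_smul]
  have hL : outer km km * outer km km = outer km km := by rw [outer_mul_outer', hkm, one_smul]
  have hKL : outer kp kp * outer km km = 0 := by rw [outer_mul_outer', hortho, zero_smul]
  have hortho' : star km ⬝ᵥ kp = 0 := by
    have := congrArg star hortho
    rwa [← Matrix.star_dotProduct_star, star_star, star_zero] at this
  have hLK : outer km km * outer kp kp = 0 := by rw [outer_mul_outer', hortho', zero_smul]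
  have hs0 : 0 ≤ Real.sqrt (1 - 4 * b) := Real.sqrt_nonneg _
  have hs2 : Real.sqrt (1 - 4 * b) ^ 2 = 1 - 4 * b := Real.sq_sqrt (by linarith)
  have hs1 : Real.sqrt (1 - 4 * b) ≤ 1 := by nlinarith
  have hl0 : 0 ≤ lam := by rw [hlam]; linarith
  have hl1 : 0 ≤ 1 - lam := by rw [hlam]; linarith
  have hlb : lam * (1 - lam) = b := by rw [hlam]; nlinarith
  have qa : (Real.sqrt a : ℂ) * (Real.sqrt a : ℂ) = a := by
    exact_mod_cast Real.mul_self_sqrt ha.le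
  have qa' : (Real.sqrt (1 - a) : ℂ) * (Real.sqrt (1 - a) : ℂ) = 1 - a := by
    exact_mod_cast Real.mul_self_sqrt (by linarith : 0 ≤ 1 - a)
  have ql : (Real.sqrt lam : ℂ) * (Real.sqrt lam : ℂ) = lam := by
    exact_mod_cast Real.mul_self_sqrt hl0
  have ql' : (Real.sqrt (1 - lam) : ℂ) * (Real.sqrt (1 - lam) : ℂ) = 1 - lam := by
    exact_mod_cast Real.mul_self_sqrt hl1
  have hlbC : (lam : ℂ) * (1 - lam) = b := by exact_mod_cast hlb
  have eφ : φ = tensorVec kp ![(Real.sqrt a : ℂ), (Real.sqrt (1 - a) : ℂ)] := by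
    rw [hφ]; ext ⟨i, j⟩; fin_cases j <;> simp [tensorVec, e₀, e₁, mul_comm]
  have eψ₁ : ψ₁ = tensorVec km ![-(Real.sqrt lam : ℂ), (Real.sqrt (1 - lam) : ℂ)] := by
    rw [hψ₁]; ext ⟨i, j⟩; fin_cases j <;> simp [tensorVec, e₀, e₁, mul_comm]
  have eψ₃ : ψ₃ = tensorVec km ![(Real.sqrt lam : ℂ), (Real.sqrt (1 - lam) : ℂ)] := by
    rw [hψ₃]; ext ⟨i, j⟩; fin_cases j <;> simp [tensorVec, e₀, e₁, mul_comm]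
  rw [eφ, eψ₁, outer_tensor, outer_tensor] at hP₁
  rw [eφ, hψ₂, outer_tensor, outer_tensor] at hP₂
  rw [eφ, eψ₃, outer_tensor, outer_tensor] at hP₃
  have n0 : star e₀ ⬝ᵥ e₀ = 1 := by simp [e₀, dotProduct]
  have n1 : star e₁ ⬝ᵥ e₁ = 1 := by simp [e₁, dotProduct]
  have nφ : star ![(Real.sqrt a : ℂ), (Real.sqrt (1 - a) : ℂ)] ⬝ᵥ
      ![(Real.sqrt a : ℂ), (Real.sqrt (1 - a) : ℂ)] = 1 := by
    simp [dotProduct, qa, qa']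
  have nψ₁ : star ![-(Real.sqrt lam : ℂ), (Real.sqrt (1 - lam) : ℂ)] ⬝ᵥ
      ![-(Real.sqrt lam : ℂ), (Real.sqrt (1 - lam) : ℂ)] = 1 := by
    simp [dotProduct, ql, ql']
  have nψ₃ : star ![(Real.sqrt lam : ℂ), (Real.sqrt (1 - lam) : ℂ)] ⬝ᵥ
      ![(Real.sqrt lam : ℂ), (Real.sqrt (1 - lam) : ℂ)] = 1 := by
    simp [dotProduct, ql, ql']
  refine ⟨⟨?_, ?_, ?_, ?_⟩, ?_⟩
  · rw [hP₀]; exact block_proj hK hL hKL hLK _ _ n0 n0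
  · rw [hP₁]; exact block_proj hK hL hKL hLK _ _ nφ nψ₁
  · rw [hP₂]; exact block_proj hK hL hKL hLK _ _ nφ n1
  · rw [hP₃]; exact block_proj hK hL hKL hLK _ _ nφ nψ₃
  · rw [hP₀, hP₁, hP₂, hP₃]
    simp only [block_mul hK hL hKL hLK, outer_mul_outer', Matrix.smul_mul, smul_smul, nφ]
    have c1 : star e₀ ⬝ᵥ ![(Real.sqrt a : ℂ), (Real.sqrt (1 - a) : ℂ)] = Real.sqrt a := by
      simp [e₀, dotProduct]
    have c2 : star ![(Real.sqrt a : ℂ), (Real.sqrt (1 - a) : ℂ)] ⬝ᵥ e₀ = Real.sqrt a := by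
      simp [e₀, dotProduct]
    have c3 : star e₀ ⬝ᵥ ![(Real.sqrt lam : ℂ), (Real.sqrt (1 - lam) : ℂ)] = Real.sqrt lam := by
      simp [e₀, dotProduct]
    have c4 : star ![(Real.sqrt lam : ℂ), (Real.sqrt (1 - lam) : ℂ)] ⬝ᵥ e₁
        = Real.sqrt (1 - lam) := by
      simp [e₁, dotProduct]
    have c5 : star e₁ ⬝ᵥ ![-(Real.sqrt lam : ℂ), (Real.sqrt (1 - lam) : ℂ)]
        = Real.sqrt (1 - lam) := by
      simp [e₁, dotProduct]
    have c6 : star ![-(Real.sqrt lam : ℂ), (Real.sqrt (1 - lam) : ℂ)] ⬝ᵥ e₀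
        = -Real.sqrt lam := by
      simp [e₀, dotProduct]
    rw [c1, c2, c3, c4, c5, c6]
    have d1 : (Real.sqrt a : ℂ) * 1 * 1 * Real.sqrt a = a := by rw [mul_one, mul_one, qa]
    have d2 : (Real.sqrt lam : ℂ) * Real.sqrt (1 - lam) * Real.sqrt (1 - lam) * (-Real.sqrt lam)
        = -b := by
      rw [← hlbC, ← ql', ← ql]; ring
    ext ⟨i, i'⟩ ⟨j, j'⟩
    simp only [Matrix.add_apply, Matrix.sub_apply, Matrix.smul_apply, Matrix.kroneckerMap_apply,
      smul_eq_mul]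
    linear_combination (outer kp kp i j * outer e₀ e₀ i' j') * d1
      + (outer km km i j * outer e₀ e₀ i' j') * d2
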